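/- For all integers n ≥ 2 and d ≥ 2, the open Waring rank satisfies Ork(n, d) ≤ binom(n+d-2, d-1). -/

import Mathlib

open MvPolynomial

noncomputable section WaringSetup

variable {k : Type} [Field k] {n : ℕ}

/-- The linear form `∑ aᵢ xᵢ` with coefficient vector `a`. -/
def linForm (a : Fin n → k) : MvPolynomial (Fin n) k :=
  ∑ i, C (a i) * X i

/-- A subset of the space `S₁` of linear forms (identified with the space of coefficient
vectors) is homogeneous Zariski closed if it is the common zero locus of a set of
homogeneous polynomial functions. -/
def HomZariskiClosed (V : Set (Fin n → k)) : Prop :=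
  ∃ P : Set (MvPolynomial (Fin n) k),
    (∀ p ∈ P, ∃ e : ℕ, p.IsHomogeneous e) ∧
    V = {a | ∀ p ∈ P, eval a p = 0}

/-- `F` can be written as a polynomial in `m` linear forms. -/
def WritableIn (m : ℕ) (F : MvPolynomial (Fin n) k) : Prop :=
  ∃ y : Fin m → MvPolynomial (Fin n) k,
    (∀ j, (y j).IsHomogeneous 1) ∧ ∃ G : MvPolynomial (Fin m) k, F = aeval y G

/-- `F` essentially depends on `n` variables: after any linear change of coordinates it
cannot be written using fewer than `n` variables. -/
def EssDep (F : MvPolynomial (Fin n) k) : Prop :=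
  ∀ m : ℕ, m < n → ¬ WritableIn m F

/-- `OrkV d F V` is the minimal number `m` such that `F` is a sum of `m` `d`-th powers of
linear forms lying outside `V` (and `⊤` if there is no such presentation). -/
def OrkV (d : ℕ) (F : MvPolynomial (Fin n) k) (V : Set (Fin n → k)) : ℕ∞ :=
  sInf ((fun m : ℕ => (m : ℕ∞)) ''
    {m : ℕ | ∃ l : Fin m → (Fin n → k), (∀ i, l i ∉ V) ∧ F = ∑ i, linForm (l i) ^ d})

/-- The open Waring rank of a form `F`: the supremum of `OrkV d F V` over all homogeneous
Zariski-closed proper subsets `V ⊊ S₁`. -/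
def Ork (d : ℕ) (F : MvPolynomial (Fin n) k) : ℕ∞ :=
  ⨆ V : {V : Set (Fin n → k) // HomZariskiClosed V ∧ V ≠ Set.univ}, OrkV d F V.1

/-- The open Waring rank `Ork(n, d)`: the supremum of `Ork F` over all forms `F` of degree
`d` essentially depending on `n` variables. -/
def OrkND (k : Type) [Field k] (n d : ℕ) : ℕ∞ :=
  ⨆ F : {F : MvPolynomial (Fin n) k // F.IsHomogeneous d ∧ EssDep F}, Ork d F.1

/-- Apply the constant-coefficient differential operator `D` (a polynomial, whose variable
`i` is read as `∂/∂xᵢ`) to the polynomial `F`. -/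
def contract (D F : MvPolynomial (Fin n) k) : MvPolynomial (Fin n) k :=
  ∑ s ∈ D.support, D.coeff s •
    ((List.finRange n).foldr (fun i G => (fun H => pderiv i H)^[s i] G) F)

/-- Polynomial functions on the affine space of polynomials: the subalgebra of functions
generated by the coefficient functionals. -/
def PolyFun (n : ℕ) (k : Type) [Field k] : Subalgebra k (MvPolynomial (Fin n) k → k) :=
  Algebra.adjoin k (Set.range fun s : Fin n →₀ ℕ => fun F => coeff s F)

end WaringSetup

noncomputable section WaringProof

open Module

variable {k : Type} [Field k] {n : ℕ}

/-! ### Orthogonal complements with respect to the dot product -/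

/-- orthogonal complement for the dot product -/
def dperp (U : Submodule k (Fin n → k)) : Submodule k (Fin n → k) :=
  LinearMap.BilinForm.orthogonal (dotProductBilin k k : LinearMap.BilinForm k (Fin n → k)) U

lemma mem_dperp {U : Submodule k (Fin n → k)} {x : Fin n → k} :
    x ∈ dperp U ↔ ∀ u ∈ U, x ⬝ᵥ u = 0 := by
  have : x ∈ dperp U ↔ ∀ u ∈ U, u ⬝ᵥ x = 0 := Iff.rfl
  rw [this]
  simp only [dotProduct_comm]

lemma dperp_dperp (U : Submodule k (Fin n → k)) : dperp (dperp U) = U := by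
  apply LinearMap.BilinForm.orthogonal_orthogonal
  · constructor
    · intro x hx
      ext i
      have := hx (Pi.single i 1)
      simpa [dotProductBilin] using this
    · intro x hx
      ext i
      have := hx (Pi.single i 1)
      simpa [dotProductBilin] using this
  · intro x y h
    have h' : x ⬝ᵥ y = 0 := h
    show y ⬝ᵥ x = 0
    rwa [dotProduct_comm]

lemma dperp_anti {U U' : Submodule k (Fin n → k)} (h : U ≤ U') : dperp U' ≤ dperp U := by
  intro x hx
  rw [mem_dperp] at *
  exact fun u hu => hx u (h hu)

lemma dperp_le_iff {U U' : Submodule k (Fin n → k)} : dperp U ≤ U' ↔ dperp U' ≤ U := by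
  constructor
  · intro h; simpa [dperp_dperp] using dperp_anti h
  · intro h; simpa [dperp_dperp] using dperp_anti h

/-- the hyperplane orthogonal to `α`. -/
def hyp (α : Fin n → k) : Submodule k (Fin n → k) := dperp (k ∙ α)

lemma mem_hyp {α x : Fin n → k} : x ∈ hyp α ↔ α ⬝ᵥ x = 0 := by
  rw [hyp, mem_dperp]
  constructor
  · intro h; rw [dotProduct_comm]; exact h α (Submodule.mem_span_singleton_self α)
  · intro h u hu
    obtain ⟨c, rfl⟩ := Submodule.mem_span_singleton.1 hu
    rw [dotProduct_smul, dotProduct_comm, h, smul_zero]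

lemma dperp_inf_hyp (W : Submodule k (Fin n → k)) (α : Fin n → k) :
    dperp (W ⊓ hyp α) = dperp W ⊔ (k ∙ α) := by
  apply le_antisymm
  · rw [dperp_le_iff]
    refine le_inf ?_ ?_
    · conv_rhs => rw [← dperp_dperp W]
      exact dperp_anti le_sup_left
    · exact dperp_anti le_sup_right
  · refine sup_le (dperp_anti inf_le_left) ?_
    conv_lhs => rw [← dperp_dperp (k ∙ α)]
    exact dperp_anti inf_le_right

lemma finrank_inf_hyp_lt {W : Submodule k (Fin n → k)} {α : Fin n → k} (h : α ∉ dperp W) :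
    finrank k (W ⊓ hyp α : Submodule k (Fin n → k)) < finrank k W := by
  apply Submodule.finrank_lt_finrank_of_lt
  refine lt_of_le_of_ne inf_le_left ?_
  intro h'
  apply h
  rw [mem_dperp]
  intro u hu
  rw [← h'] at hu
  exact mem_hyp.1 hu.2

/-! ### Directional derivatives -/

/-- directional derivative -/
def DD (δ : Fin n → k) : Derivation k (MvPolynomial (Fin n) k) (MvPolynomial (Fin n) k) :=
  mkDerivation k (fun i => C (δ i))

lemma DD_X (δ : Fin n → k) (i : Fin n) : DD δ (X i) = C (δ i) := by
  simp [DD]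

lemma DD_add_left (a b : Fin n → k) (F : MvPolynomial (Fin n) k) :
    DD (a + b) F = DD a F + DD b F := by
  have : DD (a + b) = DD a + DD b := by
    apply derivation_ext; intro i; simp [DD_X]
  rw [this]; rfl

lemma DD_smul_left (c : k) (b : Fin n → k) (F : MvPolynomial (Fin n) k) :
    DD (c • b) F = c • DD b F := by
  have : DD (c • b) = c • DD b := by
    apply derivation_ext; intro i; simp [DD_X, smul_eq_C_mul]
  rw [this]; rfl

/-- the derivative as a linear map in the direction -/
def DL (F : MvPolynomial (Fin n) k) : (Fin n → k) →ₗ[k] MvPolynomial (Fin n) k where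
  toFun δ := DD δ F
  map_add' a b := DD_add_left a b F
  map_smul' c b := DD_smul_left c b F

lemma DL_apply (F : MvPolynomial (Fin n) k) (δ : Fin n → k) : DL F δ = DD δ F := rfl

lemma DD_comm (a b : Fin n → k) (F : MvPolynomial (Fin n) k) :
    DD a (DD b F) = DD b (DD a F) := by
  have : ⁅DD a, DD b⁆ = (0 : Derivation k (MvPolynomial (Fin n) k) (MvPolynomial (Fin n) k)) := by
    apply derivation_ext; intro i
    simp [Derivation.commutator_apply, DD_X]
  have h := congrArg (fun E => E F) this
  simp only [Derivation.commutator_apply] at h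
  exact sub_eq_zero.1 h

lemma DD_single (i : Fin n) (F : MvPolynomial (Fin n) k) :
    DD (Pi.single i 1) F = pderiv i F := by
  have : DD (Pi.single i 1 : Fin n → k) = pderiv i := by
    apply derivation_ext; intro j
    by_cases h : j = i
    · subst h; simp [DD_X]
    · simp [DD_X, pderiv_X, h]
  rw [this]

lemma DD_eq_sum (δ : Fin n → k) (F : MvPolynomial (Fin n) k) :
    DD δ F = ∑ i, δ i • pderiv i F := by
  have h : DL F δ = ∑ i, δ i • DL F (Pi.single i 1) := by
    conv_lhs => rw [pi_eq_sum_univ' δ, map_sum]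
    simp
  simpa [DL_apply, DD_single] using h

lemma DD_homog (δ : Fin n → k) {F : MvPolynomial (Fin n) k} {d : ℕ} (hF : F.IsHomogeneous d) :
    (DD δ F).IsHomogeneous (d - 1) := by
  rw [DD_eq_sum]
  apply IsHomogeneous.sum
  intro i _
  exact (homogeneousSubmodule (Fin n) k (d-1)).smul_mem _ hF.pderiv

lemma linForm_homog (a : Fin n → k) : (linForm a).IsHomogeneous 1 := by
  unfold linForm
  apply IsHomogeneous.sum
  intro i _
  rw [← smul_eq_C_mul]
  exact (homogeneousSubmodule (Fin n) k 1).smul_mem _ (isHomogeneous_X k i)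

lemma linForm_pow_homog (a : Fin n → k) (d : ℕ) : (linForm a ^ d).IsHomogeneous d := by
  simpa using (linForm_homog a).pow d

lemma coeff_linForm (a : Fin n → k) (i : Fin n) : coeff (Finsupp.single i 1) (linForm a) = a i := by
  classical
  simp [linForm, coeff_sum, coeff_C_mul, coeff_X, Finsupp.single_left_inj]

lemma linForm_injective : Function.Injective (linForm : (Fin n → k) → MvPolynomial (Fin n) k) := by
  intro a b h
  ext i
  rw [← coeff_linForm a i, h, coeff_linForm]

lemma linForm_zero : linForm (0 : Fin n → k) = 0 := by simp [linForm]

lemma linForm_add (a b : Fin n → k) : linForm (a + b) = linForm a + linForm b := by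
  simp [linForm, add_mul, Finset.sum_add_distrib]

lemma linForm_smul (c : k) (a : Fin n → k) : linForm (c • a) = c • linForm a := by
  simp [linForm, smul_eq_C_mul, Finset.mul_sum, mul_assoc]

lemma linForm_ne_zero {a : Fin n → k} (h : a ≠ 0) : linForm a ≠ 0 := by
  intro h'; apply h; apply linForm_injective; rw [h', linForm_zero]

lemma DD_linForm (δ a : Fin n → k) : DD δ (linForm a) = C (δ ⬝ᵥ a) := by
  simp [linForm, DD_X, dotProduct, mul_comm]

lemma DD_pow (δ a : Fin n → k) (d : ℕ) :
    DD δ (linForm a ^ d) = ((d : k) * (δ ⬝ᵥ a)) • linForm a ^ (d - 1) := by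
  rw [Derivation.leibniz_pow, DD_linForm]
  simp [smul_eq_C_mul]
  ring

lemma eval_linForm (a x : Fin n → k) : eval x (linForm a) = a ⬝ᵥ x := by
  simp [linForm, dotProduct]

section CZ
variable [CharZero k]

lemma eq_zero_of_DD {F : MvPolynomial (Fin n) k} {d : ℕ} (hF : F.IsHomogeneous d) (hd : d ≠ 0)
    (h : ∀ δ, DD δ F = 0) : F = 0 := by
  have e := hF.sum_X_mul_pderiv
  simp only [← DD_single, h, mul_zero, Finset.sum_const_zero] at e
  rw [← Nat.cast_smul_eq_nsmul k] at e
  have := smul_eq_zero.1 e.symm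
  rcases this with h | h
  · exact absurd h (by exact_mod_cast hd)
  · exact h

end CZ

/-- directions killing `F` -/
def KK (F : MvPolynomial (Fin n) k) : Submodule k (Fin n → k) := LinearMap.ker (DL F)

lemma mem_KK {F : MvPolynomial (Fin n) k} {δ : Fin n → k} : δ ∈ KK F ↔ DD δ F = 0 := Iff.rfl

/-- the space of essential linear forms of `F` -/
def EE (F : MvPolynomial (Fin n) k) : Submodule k (Fin n → k) := dperp (KK F)

lemma dperp_EE (F : MvPolynomial (Fin n) k) : dperp (EE F) = KK F := dperp_dperp _

lemma EE_le_iff {F : MvPolynomial (Fin n) k} {W : Submodule k (Fin n → k)} :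
    EE F ≤ W ↔ dperp W ≤ KK F := dperp_le_iff

/-! ### Generic points -/

/-- `P` holds for generic elements of `W` -/
def Gen (W : Submodule k (Fin n → k)) (P : (Fin n → k) → Prop) : Prop :=
  ∃ q : MvPolynomial (Fin n) k, (∃ l ∈ W, eval l q ≠ 0) ∧ ∀ l ∈ W, eval l q ≠ 0 → P l

lemma Gen.exists {W : Submodule k (Fin n → k)} {P : (Fin n → k) → Prop} (h : Gen W P) :
    ∃ l ∈ W, P l := by
  obtain ⟨q, ⟨l, hl, hq⟩, h⟩ := h
  exact ⟨l, hl, h l hl hq⟩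

lemma Gen.mono {W : Submodule k (Fin n → k)} {P Q : (Fin n → k) → Prop} (h : Gen W P)
    (hPQ : ∀ l ∈ W, P l → Q l) : Gen W Q := by
  obtain ⟨q, h1, h⟩ := h
  exact ⟨q, h1, fun l hl hq => hPQ l hl (h l hl hq)⟩

/-- restriction of a polynomial to a line -/
lemma line_poly (q : MvPolynomial (Fin n) k) (a b : Fin n → k) :
    ∃ f : Polynomial k, ∀ t, f.eval t = eval (a + t • b) q := by
  refine ⟨aeval (fun i => Polynomial.C (a i) + Polynomial.X * Polynomial.C (b i)) q, fun t => ?_⟩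
  rw [← Polynomial.coe_evalRingHom, aeval_def, hom_eval₂]
  have e : (Polynomial.evalRingHom t).comp (algebraMap k (Polynomial k)) = RingHom.id k := by
    ext; simp
  have e2 : (fun i => (Polynomial.evalRingHom t) (Polynomial.C (a i) + Polynomial.X * Polynomial.C (b i)))
     = a + t • b := by ext i; simp; ring
  simp only [e, e2]
  rfl

lemma gen_mul [Infinite k] {W : Submodule k (Fin n → k)} {p q : MvPolynomial (Fin n) k}
    (hp : ∃ l ∈ W, eval l p ≠ 0) (hq : ∃ l ∈ W, eval l q ≠ 0) : ∃ l ∈ W, eval l (p * q) ≠ 0 := by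
  obtain ⟨a, ha, hpa⟩ := hp
  obtain ⟨b, hb, hqb⟩ := hq
  obtain ⟨f, hf⟩ := line_poly p a (b - a)
  obtain ⟨g, hg⟩ := line_poly q a (b - a)
  have hf0 : f ≠ 0 := by rintro rfl; apply hpa; simpa using (hf 0).symm
  have hg0 : g ≠ 0 := by rintro rfl; apply hqb; simpa using (hg 1).symm
  obtain ⟨t, ht⟩ : ∃ t, (f * g).eval t ≠ 0 := by
    by_contra! hcon
    exact mul_ne_zero hf0 hg0 (Polynomial.funext (by simpa using hcon))
  refine ⟨a + t • (b - a), W.add_mem ha (W.smul_mem _ (W.sub_mem hb ha)), ?_⟩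
  rwa [map_mul, ← hf, ← hg, ← Polynomial.eval_mul]

lemma Gen.and [Infinite k] {W : Submodule k (Fin n → k)} {P Q : (Fin n → k) → Prop} (h : Gen W P)
    (h' : Gen W Q) : Gen W (fun l => P l ∧ Q l) := by
  obtain ⟨q, h1, h⟩ := h
  obtain ⟨q', h1', h'⟩ := h'
  refine ⟨q * q', gen_mul h1 h1', fun l hl hq => ?_⟩
  rw [map_mul] at hq
  exact ⟨h l hl (left_ne_zero_of_mul hq), h' l hl (right_ne_zero_of_mul hq)⟩

lemma Gen.ball [Infinite k] {ι : Type*} {W : Submodule k (Fin n → k)} {P : ι → (Fin n → k) → Prop}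
    (s : Finset ι) (h : ∀ i ∈ s, Gen W (P i)) : Gen W (fun l => ∀ i ∈ s, P i l) := by
  classical
  induction s using Finset.induction_on with
  | empty => exact ⟨1, ⟨0, W.zero_mem, by simp⟩, by simp⟩
  | insert a s ha ih =>
    refine ((h a (by simp)).and (ih fun i hi => h i (by simp [hi]))).mono ?_
    rintro l _ ⟨h1, h2⟩ i hi
    rcases Finset.mem_insert.1 hi with rfl | hi
    · exact h1
    · exact h2 i hi

lemma eval_bind {σ τ : Type*} (q : σ → MvPolynomial τ k) (p : MvPolynomial σ k) (a : τ → k) :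
    eval a (bind₁ q p) = eval (fun i => eval a (q i)) p := by
  induction p using MvPolynomial.induction_on with
  | C c => simp
  | add p q hp hq => simp [hp, hq]
  | mul_X p i hp => simp [hp]

/-- polynomial functions -/
def IsPF (f : (Fin n → k) → k) : Prop := ∃ q : MvPolynomial (Fin n) k, ∀ a, f a = eval a q

lemma IsPF.add {f g : (Fin n → k) → k} (hf : IsPF f) (hg : IsPF g) : IsPF (fun a => f a + g a) := by
  obtain ⟨p, hp⟩ := hf; obtain ⟨q, hq⟩ := hg
  exact ⟨p + q, fun a => by simp [hp, hq]⟩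
lemma IsPF.sub {f g : (Fin n → k) → k} (hf : IsPF f) (hg : IsPF g) : IsPF (fun a => f a - g a) := by
  obtain ⟨p, hp⟩ := hf; obtain ⟨q, hq⟩ := hg
  exact ⟨p - q, fun a => by simp [hp, hq]⟩
lemma IsPF.mul {f g : (Fin n → k) → k} (hf : IsPF f) (hg : IsPF g) : IsPF (fun a => f a * g a) := by
  obtain ⟨p, hp⟩ := hf; obtain ⟨q, hq⟩ := hg
  exact ⟨p * q, fun a => by simp [hp, hq]⟩
lemma IsPF.const (c : k) : IsPF (fun _ : Fin n → k => c) := ⟨C c, by simp⟩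
lemma IsPF.coord (i : Fin n) : IsPF (fun a : Fin n → k => a i) := ⟨X i, by simp⟩
lemma IsPF.sum {ι : Type*} (s : Finset ι) {f : ι → (Fin n → k) → k} (h : ∀ i, IsPF (f i)) :
    IsPF (fun a => ∑ i ∈ s, f i a) := by
  choose q hq using h
  exact ⟨∑ i ∈ s, q i, fun a => by simp [hq]⟩
lemma IsPF.comp (p : MvPolynomial (Fin n) k) {f : Fin n → (Fin n → k) → k} (h : ∀ i, IsPF (f i)) :
    IsPF (fun a => eval (fun i => f i a) p) := by
  choose q hq using h
  refine ⟨bind₁ q p, fun a => ?_⟩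
  simp only [hq]
  rw [eval_bind]
lemma IsPF.dot (u : Fin n → k) : IsPF (fun a => a ⬝ᵥ u) := by
  simp only [dotProduct]
  exact IsPF.sum _ fun i => (IsPF.coord i).mul (IsPF.const _)
lemma IsPF.coeffDD (F : MvPolynomial (Fin n) k) (s : Fin n →₀ ℕ) :
    IsPF (fun a => coeff s (DD a F)) := by
  simp only [DD_eq_sum, coeff_sum, coeff_smul, smul_eq_mul]
  exact IsPF.sum _ fun i => (IsPF.coord i).mul (IsPF.const _)
lemma IsPF.coeffDDD (F : MvPolynomial (Fin n) k) (s : Fin n →₀ ℕ) :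
    IsPF (fun a => coeff s (DD a (DD a F))) := by
  simp only [DD_eq_sum, coeff_sum, coeff_smul, smul_eq_mul, map_sum, Derivation.map_smul]
  exact IsPF.sum _ fun i => (IsPF.coord i).mul
    (IsPF.sum _ fun i => (IsPF.coord i).mul (IsPF.const _))

lemma IsPF.gen {W : Submodule k (Fin n → k)} {f : (Fin n → k) → k} (hf : IsPF f)
    (h : ∃ l ∈ W, f l ≠ 0) : Gen W (fun l => f l ≠ 0) := by
  obtain ⟨q, hq⟩ := hf
  obtain ⟨l, hl, h⟩ := h
  exact ⟨q, ⟨l, hl, by rwa [← hq]⟩, fun l hl h => by show f l ≠ 0; rwa [hq]⟩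

/-! ### Finitely many hyperplanes -/

lemma linForm_irreducible {r : ℕ} {c : Fin r → k} (hc : c ≠ 0) : Irreducible (linForm c) := by
  apply irreducible_of_totalDegree_eq_one
  · exact (linForm_homog c).totalDegree (linForm_ne_zero hc)
  · intro x hx
    obtain ⟨i, hi⟩ := Function.ne_iff.1 hc
    have := hx (Finsupp.single i 1)
    rw [coeff_linForm] at this
    exact isUnit_iff_ne_zero.2 (ne_zero_of_dvd_ne_zero hi this)

lemma linForm_dvd_of_vanish [IsAlgClosed k] {r : ℕ} {c : Fin r → k} (hc : c ≠ 0)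
    {p : MvPolynomial (Fin r) k} (h : ∀ a, c ⬝ᵥ a = 0 → eval a p = 0) : linForm c ∣ p := by
  have hprime : Prime (linForm c) := (linForm_irreducible hc).prime
  have hP : (Ideal.span {linForm c}).IsPrime :=
    (Ideal.span_singleton_prime hprime.ne_zero).2 hprime
  have e := IsPrime.vanishingIdeal_zeroLocus (K := k) (Ideal.span {linForm c})
  rw [← Ideal.mem_span_singleton, ← e, mem_vanishingIdeal_iff]
  intro x hx
  change eval x p = 0
  apply h
  have : eval x (linForm c) = 0 := hx (linForm c) (Ideal.mem_span_singleton_self _)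
  rw [← eval_linForm]
  exact this

lemma FH [IsAlgClosed k] (W : Submodule k (Fin n → k)) (p : MvPolynomial (Fin n) k)
    (hp : ∃ w ∈ W, eval w p ≠ 0) :
    ∃ Δ : Finset (Fin n → k), (∀ δ ∈ Δ, δ ∉ dperp W) ∧
      ∀ δ, δ ∉ dperp W → (∀ w ∈ W, δ ⬝ᵥ w = 0 → eval w p = 0) →
        ∃ δ' ∈ Δ, ∃ t : k, t ≠ 0 ∧ δ - t • δ' ∈ dperp W := by
  classical
  let b := finBasis k W
  let pt : (Fin (finrank k W) → k) → (Fin n → k) := fun a => ((∑ j, a j • b j : W) : Fin n → k)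
  have pt_mem : ∀ a, pt a ∈ W := fun a => Submodule.coe_mem _
  have pt_surj : ∀ w ∈ W, ∃ a, pt a = w := by
    intro w hw
    refine ⟨fun j => b.repr ⟨w, hw⟩ j, ?_⟩
    show ((∑ j, b.repr ⟨w, hw⟩ j • b j : W) : Fin n → k) = w
    rw [b.sum_repr]
  let p' : MvPolynomial (Fin (finrank k W)) k :=
    bind₁ (fun i => linForm (fun j => (b j : Fin n → k) i)) p
  have hp' : ∀ a, eval a p' = eval (pt a) p := by
    intro a
    show eval a (bind₁ _ p) = _
    rw [eval_bind]
    congr 2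
    ext i
    rw [eval_linForm]
    simp [pt, dotProduct, mul_comm]
  let c : (Fin n → k) → (Fin (finrank k W) → k) := fun δ j => δ ⬝ᵥ (b j : Fin n → k)
  have hc : ∀ δ a, c δ ⬝ᵥ a = δ ⬝ᵥ pt a := by
    intro δ a
    simp only [pt, Submodule.coe_sum, Submodule.coe_smul, dotProduct_sum, dotProduct_smul]
    simp [c, dotProduct, mul_comm]
  have hc0 : ∀ δ, c δ = 0 → δ ∈ dperp W := by
    intro δ h
    rw [mem_dperp]
    intro u hu
    obtain ⟨a, rfl⟩ := pt_surj u hu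
    rw [← hc, h, zero_dotProduct]
  have hp0 : p' ≠ 0 := by
    obtain ⟨w, hw, h⟩ := hp
    obtain ⟨a, rfl⟩ := pt_surj w hw
    intro h'
    apply h
    rw [← hp', h', map_zero]
  let f : MvPolynomial (Fin (finrank k W)) k → (Fin n → k) := fun q =>
    if h : ∃ δ, δ ∉ dperp W ∧ Associated (linForm (c δ)) q then h.choose else 0
  refine ⟨(((UniqueFactorizationMonoid.factors p').toFinset).image f).filter
    (fun δ => δ ∉ dperp W), fun δ hδ => (Finset.mem_filter.1 hδ).2, ?_⟩
  intro δ hδ hv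
  have hcδ : c δ ≠ 0 := fun h => hδ (hc0 δ h)
  have hdvd : linForm (c δ) ∣ p' := by
    apply linForm_dvd_of_vanish hcδ
    intro a ha
    rw [hp']
    exact hv _ (pt_mem a) (by rw [← hc, ha])
  obtain ⟨q, hq, hassoc⟩ := UniqueFactorizationMonoid.exists_mem_factors_of_dvd hp0
    (linForm_irreducible hcδ) hdvd
  have hex : ∃ δ, δ ∉ dperp W ∧ Associated (linForm (c δ)) q := ⟨δ, hδ, hassoc⟩
  have hf : f q = hex.choose := dif_pos hex
  have hspec := hex.choose_spec
  rw [← hf] at hspec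
  refine ⟨f q, ?_, ?_⟩
  · rw [Finset.mem_filter]
    exact ⟨Finset.mem_image_of_mem _ (by simpa using hq), hspec.1⟩
  · obtain ⟨u, hu⟩ := hspec.2.trans hassoc.symm
    obtain ⟨t, ht, hut⟩ := isUnit_iff_eq_C_of_isReduced.1 u.isUnit
    refine ⟨t, ht.ne_zero, ?_⟩
    rw [hut, mul_comm, ← smul_eq_C_mul, ← linForm_smul] at hu
    have e := linForm_injective hu
    apply hc0
    have : c (δ - t • f q) = c δ - t • c (f q) := by
      ext j; simp [c, sub_dotProduct]
    rw [this, e, sub_self]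

/-! ### Linear algebra and genericity lemmas -/

lemma exists_dot_ne {u : Fin n → k} (hu : u ≠ 0) : ∃ γ : Fin n → k, γ ⬝ᵥ u ≠ 0 := by
  obtain ⟨i, hi⟩ := Function.ne_iff.1 hu
  exact ⟨Pi.single i 1, by simpa using hi⟩

lemma exists_mem_inf_hyp {W : Submodule k (Fin n → k)} (hW : 2 ≤ finrank k W) (α : Fin n → k) :
    ∃ u ∈ W, u ≠ 0 ∧ α ⬝ᵥ u = 0 := by
  let f : W →ₗ[k] k := (dotProductBilin k k α).comp W.subtype
  have hf : ∀ w : W, f w = α ⬝ᵥ (w : Fin n → k) := fun w => rfl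
  have hk : LinearMap.ker f ≠ ⊥ := by
    intro h
    have := LinearMap.finrank_le_finrank_of_injective (LinearMap.ker_eq_bot.1 h)
    simp at this
    omega
  obtain ⟨u, hu, hu0⟩ := Submodule.exists_mem_ne_zero_of_ne_bot hk
  refine ⟨u, u.2, by simpa using hu0, ?_⟩
  rw [← hf]
  exact hu

lemma not_mem_dperp_sup {W : Submodule k (Fin n → k)} (hW : 2 ≤ finrank k W) (α : Fin n → k) :
    ∃ β, β ∉ dperp W ⊔ (k ∙ α) := by
  obtain ⟨u, hu, hu0, hα⟩ := exists_mem_inf_hyp hW α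
  obtain ⟨γ, hγ⟩ := exists_dot_ne hu0
  refine ⟨γ, fun h => hγ ?_⟩
  rw [← dperp_inf_hyp, mem_dperp] at h
  exact h u ⟨hu, mem_hyp.2 hα⟩

lemma pencil {V M : Type*} [AddCommGroup V] [Module k V] [AddCommGroup M] [Module k M]
    (A B : V →ₗ[k] M) (b₁ b₂ : V)
    (hb : ∀ x y : k, x • B b₁ + y • B b₂ = 0 → x = 0 ∧ y = 0)
    (h : ∀ v, B v = 0 ∨ ∃ t : k, A v = t • B v) : ∃ c : k, A = c • B := by
  have h' : ∀ v, B v ≠ 0 → ∃ t : k, A v = t • B v := fun v hv => (h v).resolve_left hv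
  have ind : ∀ v w, (∀ x y : k, x • B v + y • B w = 0 → x = 0 ∧ y = 0) → ∀ t : k,
      A w = t • B w → A v = t • B v := by
    intro v w hvw t ht
    have hv : B v ≠ 0 := fun e => by
      have := hvw 1 0 (by simp [e])
      simp at this
    have hvw0 : B (v + w) ≠ 0 := fun e => by
      have := hvw 1 1 (by simpa using e)
      simp at this
    obtain ⟨t1, h1⟩ := h' v hv
    obtain ⟨s, hs⟩ := h' _ hvw0
    have e : (t1 - s) • B v + (t - s) • B w = 0 := by
      rw [map_add, map_add, h1, ht, smul_add] at hs
      have : (t1 - s) • B v + (t - s) • B w = (t1 • B v + t • B w) - (s • B v + s • B w) := by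
        module
      rw [this, hs, sub_self]
    obtain ⟨e1, e2⟩ := hvw _ _ e
    rw [h1, sub_eq_zero.1 e1, sub_eq_zero.1 e2]
  have hb1 : B b₁ ≠ 0 := fun e => by
    have := hb 1 0 (by simp [e])
    simp at this
  have hb2 : B b₂ ≠ 0 := fun e => by
    have := hb 0 1 (by simp [e])
    simp at this
  obtain ⟨c, hc⟩ := h' b₁ hb1
  have hc2 : A b₂ = c • B b₂ :=
    ind b₂ b₁ (fun x y e => (hb y x (by rw [add_comm]; exact e)).symm) c hc
  refine ⟨c, LinearMap.ext fun v => ?_⟩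
  rw [LinearMap.smul_apply]
  by_cases hv : B v = 0
  · obtain ⟨s1, hs1⟩ := h' (b₁ + v) (by rw [map_add, hv, add_zero]; exact hb1)
    obtain ⟨s2, hs2⟩ := h' (b₂ + v) (by rw [map_add, hv, add_zero]; exact hb2)
    rw [map_add, map_add, hv, add_zero, hc] at hs1
    rw [map_add, map_add, hv, add_zero, hc2] at hs2
    have e1 : A v = (s1 - c) • B b₁ := by rw [sub_smul, ← hs1]; abel
    have e2 : A v = (s2 - c) • B b₂ := by rw [sub_smul, ← hs2]; abel
    have := (hb (s1 - c) (-(s2 - c)) (by rw [neg_smul, ← e1, ← e2]; abel)).1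
    rw [e1, this, hv]; simp
  · by_cases hv1 : ∀ x y : k, x • B v + y • B b₁ = 0 → x = 0 ∧ y = 0
    · exact ind v b₁ hv1 c hc
    · refine ind v b₂ ?_ c hc2
      push Not at hv1
      obtain ⟨x1, y1, e, hne⟩ := hv1
      have hx1 : x1 ≠ 0 := by
        rintro rfl
        rw [zero_smul, zero_add, smul_eq_zero] at e
        exact hne rfl (e.resolve_right hb1)
      intro x y e'
      have key : (x * y1) • B b₁ + (-(x1 * y)) • B b₂ = 0 := by
        have e3 : x • (x1 • B v + y1 • B b₁) - x1 • (x • B v + y • B b₂) = 0 := by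
          rw [e, e']; simp
        rw [← e3]; module
      have := (hb _ _ key).2
      have hy : y = 0 := by
        rcases mul_eq_zero.1 (neg_eq_zero.1 this) with h | h
        · exact absurd h hx1
        · exact h
      rw [hy, zero_smul, add_zero, smul_eq_zero] at e'
      exact ⟨e'.resolve_right hv, hy⟩

lemma Gen.top_coeffDD {F : MvPolynomial (Fin n) k} (h : ∃ α, DD α F ≠ 0) :
    Gen (⊤ : Submodule k (Fin n → k)) (fun α => DD α F ≠ 0) := by
  obtain ⟨α, hα⟩ := h
  obtain ⟨s, hs⟩ := ne_zero_iff.1 hα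
  refine ((IsPF.coeffDD F s).gen ⟨α, Submodule.mem_top, hs⟩).mono ?_
  intro l _ hl h0
  apply hl
  rw [h0, coeff_zero]

/-- coefficients of a form of degree one -/
def lc (G : MvPolynomial (Fin n) k) : Fin n → k := fun i => coeff (Finsupp.single i 1) G

lemma linForm_lc {G : MvPolynomial (Fin n) k} (hG : G.IsHomogeneous 1) : G = linForm (lc G) := by
  ext s
  by_cases hs : ∃ i, s = Finsupp.single i 1
  · obtain ⟨i, rfl⟩ := hs
    rw [coeff_linForm]; rfl
  · have hdeg : s.degree ≠ 1 := by
      intro h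
      exact hs ((Finsupp.sum_eq_one_iff s).1 h)
    rw [hG.coeff_eq_zero hdeg, (linForm_homog _).coeff_eq_zero hdeg]

lemma lc_mem_EE {F : MvPolynomial (Fin n) k} (hF : F.IsHomogeneous 2) (α : Fin n → k) :
    lc (DD α F) ∈ EE F := by
  rw [EE, mem_dperp]
  intro δ hδ
  rw [mem_KK] at hδ
  have : DD δ (DD α F) = 0 := by rw [DD_comm, hδ, map_zero]
  rw [linForm_lc (DD_homog α hF), DD_linForm] at this
  rw [dotProduct_comm]
  exact C_injective _ _ (by rw [this, C_0])

section CZ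
variable [CharZero k]

/-- two derivatives -/
lemma gen_DD_of_not_mem_KK {F : MvPolynomial (Fin n) k} {d : ℕ} (hF : F.IsHomogeneous d)
    (hd : 2 ≤ d) {δ : Fin n → k} (hδ : δ ∉ KK F) :
    Gen (⊤ : Submodule k (Fin n → k)) (fun α => DD δ (DD α F) ≠ 0) := by
  have : Gen (⊤ : Submodule k (Fin n → k)) (fun α => DD α (DD δ F) ≠ 0) := by
    apply Gen.top_coeffDD
    by_contra! h
    exact hδ (mem_KK.2 (eq_zero_of_DD (DD_homog δ hF) (by omega) h))
  exact this.mono fun l _ h => by rwa [DD_comm]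

lemma gen_DDD {F : MvPolynomial (Fin n) k} {d : ℕ} (hF : F.IsHomogeneous d)
    (hd : 2 ≤ d) (hF0 : F ≠ 0) :
    Gen (⊤ : Submodule k (Fin n → k)) (fun α => DD α (DD α F) ≠ 0) := by
  have : ∃ α, DD α (DD α F) ≠ 0 := by
    by_contra! h
    apply hF0
    apply eq_zero_of_DD hF (by omega)
    intro β
    apply eq_zero_of_DD (DD_homog β hF) (by omega)
    intro α
    have := h (α + β)
    rw [DD_add_left, DD_add_left, map_add, map_add, h α, h β, DD_comm β α, zero_add, add_zero,
      ← two_smul k, smul_eq_zero] at this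
    exact this.resolve_left two_ne_zero
  obtain ⟨α, hα⟩ := this
  obtain ⟨s, hs⟩ := ne_zero_iff.1 hα
  refine ((IsPF.coeffDDD F s).gen ⟨α, Submodule.mem_top, hs⟩).mono ?_
  intro l _ hl h0
  apply hl
  rw [h0, coeff_zero]

lemma gen_pencil {F Y : MvPolynomial (Fin n) k} {d : ℕ} (hF : F.IsHomogeneous d)
    (hY : Y.IsHomogeneous d) (hd : 2 ≤ d) (hr : 2 ≤ finrank k (EE F))
    (hYF : ∀ t : k, Y ≠ t • F) :
    Gen (⊤ : Submodule k (Fin n → k)) (fun α => ∀ t : k, DD α Y ≠ t • DD α F) := by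
  have : ∃ α, DD α F ≠ 0 ∧ ∀ t : k, DD α Y ≠ t • DD α F := by
    by_contra! h
    obtain ⟨b1, hb1⟩ := not_mem_dperp_sup hr 0
    have hb1 : b1 ∉ KK F := fun h => hb1 (Submodule.mem_sup_left (by rwa [dperp_EE]))
    obtain ⟨b2, hb2⟩ := not_mem_dperp_sup hr b1
    rw [dperp_EE] at hb2
    obtain ⟨c, hc⟩ := pencil (DL Y) (DL F) b2 b1 (by
      intro x y e
      have hx : x = 0 := by
        by_contra hx
        apply hb2
        rw [Submodule.mem_sup]
        refine ⟨b2 + (x⁻¹ * y) • b1, ?_, -(x⁻¹ * y) • b1,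
          Submodule.smul_mem _ _ (Submodule.mem_span_singleton_self _), by module⟩
        show DL F _ = 0
        have e' : x⁻¹ • (x • (DL F) b2 + y • (DL F) b1) = 0 := by rw [e, smul_zero]
        rw [smul_add, smul_smul, smul_smul, inv_mul_cancel₀ hx, one_smul] at e'
        simpa using e'
      subst hx
      rw [zero_smul, zero_add, smul_eq_zero] at e
      exact ⟨rfl, e.resolve_right hb1⟩) (fun v => by
        by_cases hv : DD v F = 0
        · exact Or.inl hv
        · exact Or.inr (h v hv))
    apply hYF c
    rw [← sub_eq_zero]
    apply eq_zero_of_DD (d := d)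
    · exact hY.sub ((homogeneousSubmodule (Fin n) k d).smul_mem c hF)
    · omega
    · intro δ
      have := LinearMap.congr_fun hc δ
      rw [LinearMap.smul_apply, DL_apply, DL_apply] at this
      rw [map_sub, this, Derivation.map_smul, sub_self]
  obtain ⟨α, hα0, hα⟩ := this
  have : ∃ s s', coeff s (DD α Y) * coeff s' (DD α F) - coeff s' (DD α Y) * coeff s (DD α F) ≠ 0 := by
    by_contra! h
    obtain ⟨s', hs'⟩ := ne_zero_iff.1 hα0
    apply hα (coeff s' (DD α Y) / coeff s' (DD α F))
    ext s
    rw [coeff_smul, smul_eq_mul]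
    have := h s s'
    field_simp
    linear_combination this
  obtain ⟨s, s', hs⟩ := this
  refine ((((IsPF.coeffDD Y s).mul (IsPF.coeffDD F s')).sub
    ((IsPF.coeffDD Y s').mul (IsPF.coeffDD F s))).gen ⟨α, Submodule.mem_top, hs⟩).mono ?_
  intro l _ hl t ht
  apply hl
  rw [ht, coeff_smul, coeff_smul, smul_eq_mul, smul_eq_mul]
  ring

lemma exists_lc {F : MvPolynomial (Fin n) k} (hF : F.IsHomogeneous 2) {w : Fin n → k}
    (hw : w ∈ EE F) : ∃ α, lc (DD α F) = w := by
  let M : (Fin n → k) →ₗ[k] (Fin n → k) :=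
    { toFun := fun α => lc (DD α F)
      map_add' := fun a b => by ext i; simp [lc, DD_add_left]
      map_smul' := fun a b => by ext i; simp [lc, DD_smul_left] }
  have h : EE F ≤ LinearMap.range M := by
    rw [EE_le_iff]
    intro δ hδ
    rw [mem_dperp] at hδ
    apply eq_zero_of_DD (DD_homog δ hF) (by norm_num)
    intro α
    show DD α (DD δ F) = 0
    rw [DD_comm, linForm_lc (DD_homog α hF), DD_linForm]
    have : δ ⬝ᵥ lc (DD α F) = 0 := hδ _ ⟨α, rfl⟩
    rw [this, C_0]
  exact h hw

lemma gen_lc {F : MvPolynomial (Fin n) k} (hF : F.IsHomogeneous 2) {p : MvPolynomial (Fin n) k}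
    (hp : ∃ w ∈ EE F, eval w p ≠ 0) :
    Gen (⊤ : Submodule k (Fin n → k)) (fun α => eval (lc (DD α F)) p ≠ 0) := by
  obtain ⟨w, hw, hpw⟩ := hp
  obtain ⟨α, rfl⟩ := exists_lc hF hw
  exact IsPF.gen (IsPF.comp p fun i => IsPF.coeffDD F _) ⟨α, Submodule.mem_top, hpw⟩

/-- a form depending on one variable is a power -/
lemma eq_pow_of_KK {e : Fin n → k} (he : e ≠ 0) (d : ℕ) :
    ∀ {F : MvPolynomial (Fin n) k}, F.IsHomogeneous d → (∀ δ, δ ⬝ᵥ e = 0 → DD δ F = 0) →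
      ∃ c : k, F = c • linForm e ^ d := by
  obtain ⟨α, hα⟩ := exists_dot_ne he
  induction d with
  | zero =>
    intro F hF h
    refine ⟨coeff 0 F, ?_⟩
    have := totalDegree_eq_zero_iff_eq_C.1 (Nat.le_zero.1 hF.totalDegree_le)
    rw [pow_zero, smul_eq_C_mul, mul_one]; exact this
  | succ d ih =>
    intro F hF h
    obtain ⟨c, hc⟩ := ih (F := DD α F) (DD_homog α hF) (by
      intro δ hδ; rw [DD_comm, h δ hδ, map_zero])
    have hd0 : ((d + 1 : ℕ) : k) ≠ 0 := by exact_mod_cast Nat.succ_ne_zero d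
    refine ⟨c / ((d + 1 : ℕ) * (α ⬝ᵥ e)), ?_⟩
    rw [← sub_eq_zero]
    apply eq_zero_of_DD (d := d + 1)
    · exact hF.sub ((homogeneousSubmodule (Fin n) k (d+1)).smul_mem _ (linForm_pow_homog e _))
    · omega
    · intro δ
      have h1 := h (δ - ((δ ⬝ᵥ e) / (α ⬝ᵥ e)) • α) (by
        rw [sub_dotProduct, smul_dotProduct, smul_eq_mul]; field_simp; simp)
      have h2 : DD δ F = ((δ ⬝ᵥ e) / (α ⬝ᵥ e)) • DD α F := by
        have : DL F (δ - ((δ ⬝ᵥ e) / (α ⬝ᵥ e)) • α) = 0 := h1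
        rw [map_sub, map_smul, sub_eq_zero] at this
        exact this
      rw [map_sub, Derivation.map_smul, DD_pow, h2, hc, Nat.add_sub_cancel, smul_smul, smul_smul,
        ← sub_smul]
      have : δ ⬝ᵥ e / α ⬝ᵥ e * c - c / (((d + 1 : ℕ) : k) * α ⬝ᵥ e) * (((d + 1 : ℕ) : k) * δ ⬝ᵥ e) = 0 := by
        field_simp; ring
      rw [this, zero_smul]

end CZ

/-! ### Weighted decompositions -/

/-- weighted sum of powers of linear forms -/
def PW (d : ℕ) (s : List (k × (Fin n → k))) : MvPolynomial (Fin n) k :=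
  (s.map fun x => x.1 • linForm x.2 ^ d).sum

/-- change the weights -/
def tw (φ : (Fin n → k) → k) (s : List (k × (Fin n → k))) : List (k × (Fin n → k)) :=
  s.map fun x => (x.1 * φ x.2, x.2)

lemma PW_nil (d : ℕ) : PW d ([] : List (k × (Fin n → k))) = 0 := rfl

lemma PW_cons (d : ℕ) (x : k × (Fin n → k)) (s : List (k × (Fin n → k))) :
    PW d (x :: s) = x.1 • linForm x.2 ^ d + PW d s := by simp [PW]

lemma PW_append (d : ℕ) (s s' : List (k × (Fin n → k))) :
    PW d (s ++ s') = PW d s + PW d s' := by simp [PW]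

lemma tw_nil (φ : (Fin n → k) → k) : tw φ ([] : List (k × (Fin n → k))) = [] := rfl

lemma tw_cons (φ : (Fin n → k) → k) (x : k × (Fin n → k)) (s : List (k × (Fin n → k))) :
    tw φ (x :: s) = (x.1 * φ x.2, x.2) :: tw φ s := rfl

lemma tw_append (φ : (Fin n → k) → k) (s s' : List (k × (Fin n → k))) :
    tw φ (s ++ s') = tw φ s ++ tw φ s' := by simp [tw]

lemma tw_length (φ : (Fin n → k) → k) (s : List (k × (Fin n → k))) :
    (tw φ s).length = s.length := by simp [tw]

lemma tw_tw (φ ψ : (Fin n → k) → k) (s : List (k × (Fin n → k))) :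
    tw φ (tw ψ s) = tw (fun l => ψ l * φ l) s := by simp [tw, mul_assoc]

lemma tw_congr {φ ψ : (Fin n → k) → k} {s : List (k × (Fin n → k))}
    (h : ∀ x ∈ s, φ x.2 = ψ x.2) : tw φ s = tw ψ s := by
  unfold tw
  apply List.map_congr_left
  intro x hx
  rw [h x hx]

lemma tw_one (s : List (k × (Fin n → k))) : tw (fun _ => 1) s = s := by simp [tw]

lemma mem_tw {φ : (Fin n → k) → k} {s : List (k × (Fin n → k))} {x : k × (Fin n → k)}
    (h : x ∈ tw φ s) : ∃ y ∈ s, y.2 = x.2 := by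
  obtain ⟨y, hy, rfl⟩ := List.mem_map.1 h
  exact ⟨y, hy, rfl⟩

lemma DD_PW (α : Fin n → k) (d : ℕ) (s : List (k × (Fin n → k))) :
    DD α (PW d s) = PW (d - 1) (tw (fun l => (d : k) * (α ⬝ᵥ l)) s) := by
  induction s with
  | nil => simp [PW_nil, tw_nil]
  | cons x s ih =>
    rw [PW_cons, tw_cons, PW_cons, map_add, Derivation.map_smul, DD_pow, ih, smul_smul]

lemma PW_tw_zero (d : ℕ) {φ : (Fin n → k) → k} {s : List (k × (Fin n → k))}
    (h : ∀ x ∈ s, φ x.2 = 0) : PW d (tw φ s) = 0 := by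
  induction s with
  | nil => rfl
  | cons x s ih =>
    rw [tw_cons, PW_cons, ih fun y hy => h y (by simp [hy]), h x (by simp)]
    simp

lemma PW_homog (d : ℕ) (s : List (k × (Fin n → k))) : (PW d s).IsHomogeneous d := by
  induction s with
  | nil => exact isHomogeneous_zero _ _ _
  | cons x s ih =>
    rw [PW_cons]
    exact ((homogeneousSubmodule (Fin n) k d).smul_mem _ (linForm_pow_homog _ _)).add ih

/-- side conditions: pairs of a form and a weight function -/
abbrev Side (k : Type) [Field k] (n : ℕ) : Type :=
  List (MvPolynomial (Fin n) k × ((Fin n → k) → k))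

/-- `F` has a decomposition with at most `m` terms in `W`, outside of `p = 0`,
such that none of the side conditions is an identity. -/
def Dec (d m : ℕ) (F : MvPolynomial (Fin n) k) (W : Submodule k (Fin n → k))
    (p : MvPolynomial (Fin n) k) (L : Side k n) : Prop :=
  ∃ s : List (k × (Fin n → k)), s.length ≤ m ∧ (∀ x ∈ s, x.2 ∈ W ∧ eval x.2 p ≠ 0) ∧
    F = PW d s ∧ ∀ y ∈ L, y.1 ≠ PW d (tw y.2 s)

lemma Dec.mono {d m m' : ℕ} {F : MvPolynomial (Fin n) k} {W W' : Submodule k (Fin n → k)}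
    {p : MvPolynomial (Fin n) k} {L : Side k n} (h : Dec d m F W p L) (hm : m ≤ m') (hW : W ≤ W') :
    Dec d m' F W' p L := by
  obtain ⟨s, h1, h2, h3, h4⟩ := h
  exact ⟨s, h1.trans hm, fun x hx => ⟨hW (h2 x hx).1, (h2 x hx).2⟩, h3, h4⟩

/-- the bound -/
def NN (r d : ℕ) : ℕ := (r - 1 + (d - 1)).choose (d - 1)

lemma NN_mono {r r' : ℕ} (d : ℕ) (h : r ≤ r') : NN r d ≤ NN r' d :=
  Nat.choose_le_choose _ (by omega)

lemma NN_one (r : ℕ) : NN r 1 = 1 := by simp [NN]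

lemma NN_rec {r d : ℕ} (hr : 2 ≤ r) (hd : 2 ≤ d) : NN r d = NN r (d - 1) + NN (r - 1) d := by
  obtain ⟨r, rfl⟩ := Nat.exists_eq_add_of_le hr
  obtain ⟨d, rfl⟩ := Nat.exists_eq_add_of_le hd
  unfold NN
  have e1 : 2 + r - 1 + (2 + d - 1) = (r + d + 1) + 1 := by omega
  have e2 : 2 + d - 1 = d + 1 := by omega
  have e3 : 2 + r - 1 + (d + 1 - 1) = r + d + 1 := by omega
  have e4 : 2 + r - 1 - 1 + (d + 1) = r + d + 1 := by omega
  rw [e1, e2, e3, e4, Nat.choose_succ_succ, Nat.add_sub_cancel]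

lemma NN_pos (r d : ℕ) : 1 ≤ NN r d := Nat.choose_pos (by omega)

lemma NN_succ {r r' d : ℕ} (hr : 2 ≤ r') (hd : 2 ≤ d) (h : r + 1 ≤ r') : NN r d + 1 ≤ NN r' d := by
  rw [NN_rec hr hd]
  have := NN_mono d (show r ≤ r' - 1 by omega)
  have := NN_pos r' (d - 1)
  omega

/-- admissible side conditions -/
def SideOK (d : ℕ) (F : MvPolynomial (Fin n) k) (L : Side k n) : Prop :=
  ∀ y ∈ L, y.1.IsHomogeneous d ∧ ∀ t : k, y.1 ≠ t • F

/-- the main claim for given degree and rank -/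
def TT (k : Type) [Field k] (n d r : ℕ) : Prop :=
  ∀ (F : MvPolynomial (Fin n) k), F.IsHomogeneous d → finrank k (EE F) = r →
    ∀ (p : MvPolynomial (Fin n) k) (L : Side k n), (∃ w ∈ EE F, eval w p ≠ 0) →
      SideOK d F L → Dec d (NN r d) F (EE F) p L

/-- the hypothesis on hyperplanes -/
def HypOK (W : Submodule k (Fin n → k)) (F p : MvPolynomial (Fin n) k) : Prop :=
  ∀ δ, δ ∉ dperp W → (∀ w ∈ W, δ ⬝ᵥ w = 0 → eval w p = 0) → DD δ F ≠ 0

lemma Gen.lball [Infinite k] {ι : Type*} {W : Submodule k (Fin n → k)}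
    {P : ι → (Fin n → k) → Prop}
    (s : List ι) (h : ∀ i ∈ s, Gen W (P i)) : Gen W (fun l => ∀ i ∈ s, P i l) := by
  classical
  refine (Gen.ball s.toFinset (P := P) fun i hi => h i (by simpa using hi)).mono ?_
  intro l _ hl i hi
  exact hl i (by simpa using hi)

section CZ
variable [CharZero k]

lemma gen_not_power {W : Submodule k (Fin n → k)} {F Y p : MvPolynomial (Fin n) k} {d : ℕ}
    (hd : 2 ≤ d) (hW : 2 ≤ finrank k W)
    (hEp : ∀ w ∈ EE F, eval w p = 0)
    (hYF : ∀ t : k, Y ≠ t • F) :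
    Gen W (fun a => eval a p ≠ 0 → ∀ t c : k, Y - t • F ≠ c • linForm a ^ d) := by
  have key : ∀ a, eval a p ≠ 0 → ∃ δ ∈ KK F, δ ⬝ᵥ a ≠ 0 := by
    intro a ha
    by_contra! h
    apply ha
    apply hEp
    rw [EE, mem_dperp]
    intro u hu
    rw [dotProduct_comm]
    exact h u hu
  have der : ∀ δ ∈ KK F, ∀ (a : Fin n → k) (t c : k), Y - t • F = c • linForm a ^ d →
      DD δ Y = (c * (d * (δ ⬝ᵥ a))) • linForm a ^ (d - 1) := by
    intro δ hδ a t c h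
    have := congrArg (DD δ) h
    rw [map_sub, Derivation.map_smul, mem_KK.1 hδ, smul_zero, sub_zero, Derivation.map_smul,
      DD_pow, smul_smul] at this
    exact this
  have hd0 : (d : k) ≠ 0 := by exact_mod_cast (by omega : d ≠ 0)
  by_cases hbad : ∃ b, eval b p ≠ 0 ∧ ∃ t c : k, Y - t • F = c • linForm b ^ d
  · obtain ⟨b, hb, t, c, hbt⟩ := hbad
    obtain ⟨γ, hγ⟩ : ∃ γ, γ ⬝ᵥ b = 0 ∧ ∃ w ∈ W, γ ⬝ᵥ w ≠ 0 := by
      by_contra! h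
      have : W ≤ (k ∙ b) := by
        rw [← dperp_dperp (k ∙ b)]
        intro w hw
        rw [mem_dperp]
        intro u hu
        rw [dotProduct_comm]
        refine h u ?_ w hw
        exact mem_dperp.1 hu b (Submodule.mem_span_singleton_self b)
      have := Submodule.finrank_mono this
      have := finrank_span_le_card (R := k) ({b} : Set (Fin n → k))
      simp at this
      omega
    obtain ⟨hγb, w, hw, hγw⟩ := hγ
    refine ((IsPF.dot γ).gen ⟨w, hw, by rwa [dotProduct_comm]⟩).mono ?_
    intro a ha hγa hpa t' c' hat
    obtain ⟨δ, hδ, hδa⟩ := key a hpa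
    have e1 := der δ hδ a t' c' hat
    have e2 := der δ hδ b t c hbt
    rw [e1] at e2
    have e3 := congrArg (eval γ) e2
    simp only [smul_eval, map_pow, eval_linForm] at e3
    rw [dotProduct_comm b, hγb, zero_pow (by omega), mul_zero] at e3
    have hc' : c' ≠ 0 := by
      rintro rfl
      rw [zero_smul, sub_eq_zero] at hat
      exact hYF _ hat
    exact mul_ne_zero (mul_ne_zero hc' (mul_ne_zero hd0 hδa)) (pow_ne_zero _ hγa) e3
  · push Not at hbad
    exact ⟨1, ⟨0, W.zero_mem, by simp⟩, fun a ha _ hpa => hbad a hpa⟩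

lemma U_of_T {W : Submodule k (Fin n → k)} {F p : MvPolynomial (Fin n) k} {d : ℕ} {L : Side k n}
    (hT : ∀ r ≤ finrank k W, TT k n d r)
    (hd : 2 ≤ d) (hF : F.IsHomogeneous d) (hFW : EE F ≤ W)
    (hp : ∃ w ∈ W, eval w p ≠ 0) (hH : HypOK W F p) (hL : SideOK d F L) :
    Dec d (NN (finrank k W) d) F W p L := by
  by_cases hE : ∃ w ∈ EE F, eval w p ≠ 0
  · have hle := Submodule.finrank_mono hFW
    exact (hT _ hle F hF rfl p L hE hL).mono (NN_mono d hle) hFW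
  push Not at hE
  obtain ⟨δ, hδ, hδW⟩ : ∃ δ ∈ KK F, δ ∉ dperp W := by
    by_contra! h
    have h2 : W ≤ EE F := by
      have := dperp_anti (show KK F ≤ dperp W from h)
      rwa [dperp_dperp] at this
    obtain ⟨w, hw, hpw⟩ := hp
    exact hpw (hE w (h2 hw))
  obtain ⟨w1, hw1, hδw1, hpw1⟩ : ∃ w ∈ W, δ ⬝ᵥ w = 0 ∧ eval w p ≠ 0 := by
    by_contra! h
    exact hH δ hδW h hδ
  have hEW' : EE F ≤ W ⊓ hyp δ := by
    refine le_inf hFW ?_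
    intro u hu
    rw [mem_hyp, dotProduct_comm]
    exact mem_dperp.1 hu δ hδ
  have hlt1 : finrank k (EE F) < finrank k (W ⊓ hyp δ : Submodule k (Fin n → k)) := by
    apply Submodule.finrank_lt_finrank_of_lt
    refine lt_of_le_of_ne hEW' ?_
    intro h
    apply hpw1
    apply hE
    rw [h]
    exact ⟨hw1, mem_hyp.2 hδw1⟩
  have hlt2 := finrank_inf_hyp_lt hδW
  have hW2 : 2 ≤ finrank k W := by omega
  have g1 : Gen W (fun a => eval a p ≠ 0) := ⟨p, hp, fun _ _ h => h⟩
  have g2 : Gen W (fun a => ∀ y ∈ L, eval a p ≠ 0 → ∀ t c : k,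
      y.1 - t • F ≠ c • linForm a ^ d) :=
    Gen.lball L fun y hy => gen_not_power hd hW2 hE (hL y hy).2
  obtain ⟨a, haW, hpa, haL⟩ := (g1.and g2).exists
  obtain ⟨η, hη, hηa⟩ : ∃ η ∈ KK F, η ⬝ᵥ a ≠ 0 := by
    by_contra! h
    apply hpa
    apply hE
    rw [EE, mem_dperp]
    intro u hu
    rw [dotProduct_comm]
    exact h u hu
  have ha0 : a ≠ 0 := by rintro rfl; simp at hηa
  have hFt : (F + linForm a ^ d).IsHomogeneous d := hF.add (linForm_pow_homog a d)
  have hEFt : EE (F + linForm a ^ d) ≤ EE F ⊔ (k ∙ a) := by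
    rw [EE_le_iff]
    intro δ hδ
    have h1 : δ ∈ KK F := by
      rw [← dperp_EE]; exact dperp_anti le_sup_left hδ
    have h2 : δ ⬝ᵥ a = 0 :=
      mem_dperp.1 hδ a (Submodule.mem_sup_right (Submodule.mem_span_singleton_self a))
    rw [mem_KK, map_add, DD_pow, mem_KK.1 h1, h2]
    simp
  have haE : a ∈ EE (F + linForm a ^ d) := by
    rw [EE, mem_dperp]
    intro δ hδ
    rw [mem_KK, map_add, DD_pow] at hδ
    have h := congrArg (DD η) hδ
    rw [map_add, DD_comm, mem_KK.1 hη, map_zero, map_zero, zero_add, Derivation.map_smul, DD_pow,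
      smul_smul, smul_eq_zero] at h
    rcases h with h | h
    · have hd0 : (d : k) ≠ 0 := by exact_mod_cast (by omega : d ≠ 0)
      have hd1 : ((d - 1 : ℕ) : k) ≠ 0 := by exact_mod_cast (by omega : d - 1 ≠ 0)
      rw [dotProduct_comm]
      simpa [hd0, hd1, hηa] using h
    · exact absurd h (pow_ne_zero _ (linForm_ne_zero ha0))
  have hfr : finrank k (EE (F + linForm a ^ d)) ≤ finrank k (EE F) + 1 := by
    refine (Submodule.finrank_mono hEFt).trans ((Submodule.finrank_add_le_finrank_add_finrank _ _).trans ?_)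
    have := finrank_span_le_card (R := k) ({a} : Set (Fin n → k))
    simp at this
    omega
  obtain ⟨s, hs1, hs2, hs3, hs4⟩ := hT _ (by omega) _ hFt rfl p
    (L.map fun y => (y.1 + y.2 a • linForm a ^ d, y.2)) ⟨a, haE, hpa⟩ (by
      intro y hy
      obtain ⟨y, hyL, rfl⟩ := List.mem_map.1 hy
      refine ⟨(hL y hyL).1.add ((homogeneousSubmodule (Fin n) k d).smul_mem _
        (linForm_pow_homog a d)), ?_⟩
      intro t ht
      apply haL y hyL hpa t (t - y.2 a)
      simp only [smul_add] at ht
      rw [sub_smul, sub_eq_sub_iff_add_eq_add, ht]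
      abel)
  refine ⟨(-1, a) :: s, ?_, ?_, ?_, ?_⟩
  · have := NN_succ (r := finrank k (EE (F + linForm a ^ d))) hW2 hd (by omega)
    simp only [List.length_cons]
    omega
  · intro x hx
    rcases List.mem_cons.1 hx with rfl | hx
    · exact ⟨haW, hpa⟩
    · refine ⟨(sup_le hFW ?_) (hEFt (hs2 x hx).1), (hs2 x hx).2⟩
      rw [Submodule.span_singleton_le_iff_mem]; exact haW
  · rw [PW_cons, ← hs3]; simp
  · intro y hy h
    apply hs4 _ (List.mem_map_of_mem hy)
    rw [tw_cons, PW_cons] at h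
    simp only
    rw [h]
    simp

end CZ

/-! ### The induction -/

lemma DD_of_sub_mem {G : MvPolynomial (Fin n) k} {W : Submodule k (Fin n → k)}
    {δ δ' : Fin n → k} {t : k}
    (h : δ - t • δ' ∈ W) (hW : W ≤ KK G) : DD δ G = t • DD δ' G := by
  have : DL G (δ - t • δ') = 0 := hW h
  rw [map_sub, map_smul, sub_eq_zero] at this
  exact this

lemma single_side {d : ℕ} {F : MvPolynomial (Fin n) k} {L : Side k n} (hL : SideOK d F L)
    {c : k} {l : Fin n → k} (h : F = c • linForm l ^ d) :
    ∀ y ∈ L, y.1 ≠ PW d (tw y.2 [(c, l)]) := by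
  intro y hy e
  apply (hL y hy).2 (y.2 l)
  rw [e, h, tw_cons, PW_cons, tw_nil, PW_nil, add_zero, smul_smul, mul_comm]

section CZ
variable [CharZero k]

lemma T_zero (d : ℕ) (hd : 2 ≤ d) : TT k n d 0 := by
  intro F hF hr p L hp hL
  have hE : EE F = ⊥ := Submodule.finrank_eq_zero.1 hr
  have hF0 : F = 0 := by
    apply eq_zero_of_DD hF (by omega)
    intro δ
    have : δ ∈ KK F := by
      rw [← dperp_EE, hE, mem_dperp]
      intro u hu
      rw [(Submodule.mem_bot k).1 hu, dotProduct_zero]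
    exact this
  refine ⟨[], by simp, by simp, by rw [hF0, PW_nil], ?_⟩
  intro y hy
  rw [tw_nil, PW_nil]
  simpa using (hL y hy).2 0

lemma T_one (d : ℕ) : TT k n d 1 := by
  intro F hF hr p L hp hL
  have hne : EE F ≠ ⊥ := by
    intro h; rw [h] at hr; simp at hr
  obtain ⟨e, heE, he0⟩ := Submodule.exists_mem_ne_zero_of_ne_bot hne
  obtain ⟨γ, hγ⟩ := exists_dot_ne he0
  obtain ⟨l, hl, hpl⟩ := gen_mul hp ⟨e, heE, show eval e (linForm γ) ≠ 0 by rwa [eval_linForm]⟩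
  rw [map_mul, eval_linForm] at hpl
  have hl0 : l ≠ 0 := by rintro rfl; simp at hpl
  have hspan : EE F = k ∙ l := by
    symm
    apply Submodule.eq_of_le_of_finrank_eq
    · rw [Submodule.span_singleton_le_iff_mem]; exact hl
    · rw [finrank_span_singleton hl0, hr]
  obtain ⟨c, hc⟩ := eq_pow_of_KK hl0 d hF (by
    intro δ hδ
    have : δ ∈ KK F := by
      rw [← dperp_EE, hspan]
      have := (mem_hyp (α := l) (x := δ)).2 (by rwa [dotProduct_comm])
      exact this
    exact this)
  refine ⟨[(c, l)], NN_pos _ _, ?_, ?_, single_side hL hc⟩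
  · intro x hx
    rw [List.mem_singleton.1 hx]
    exact ⟨hl, left_ne_zero_of_mul hpl⟩
  · rw [PW_cons, PW_nil, add_zero]; exact hc

/-- choice of a generic direction -/
lemma exists_direction [IsAlgClosed k] {F p : MvPolynomial (Fin n) k} {d : ℕ} {L : Side k n}
    (hd : 2 ≤ d) (hF : F.IsHomogeneous d) (hr : 2 ≤ finrank k (EE F))
    (hp : ∃ w ∈ EE F, eval w p ≠ 0) (hL : SideOK d F L) :
    ∃ α, α ∉ dperp (EE F) ∧ (∃ w ∈ EE F ⊓ hyp α, eval w p ≠ 0) ∧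
      DD α (DD α F) ≠ 0 ∧ (∀ y ∈ L, ∀ t : k, DD α y.1 ≠ t • DD α F) ∧
      (d = 2 → eval (lc (DD α F)) p ≠ 0) ∧
      HypOK (EE F) (DD α F) (p * linForm α) := by
  obtain ⟨Δ, hΔ1, hΔ2⟩ := FH (EE F) p hp
  have hF0 : F ≠ 0 := by
    rintro rfl
    obtain ⟨β, hβ⟩ := not_mem_dperp_sup hr 0
    apply hβ
    apply Submodule.mem_sup_left
    rw [dperp_EE, mem_KK, map_zero]
  have g0 : Gen (⊤ : Submodule k (Fin n → k)) (fun α => α ∉ dperp (EE F)) := by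
    obtain ⟨u, hu, hu0, -⟩ := exists_mem_inf_hyp hr 0
    obtain ⟨γ, hγ⟩ := exists_dot_ne hu0
    refine ((IsPF.dot u).gen ⟨γ, Submodule.mem_top, hγ⟩).mono ?_
    intro α _ h h'
    exact h (mem_dperp.1 h' u hu)
  have g1 : Gen (⊤ : Submodule k (Fin n → k))
      (fun α => ∀ δ ∈ Δ, ∃ u ∈ EE F, δ ⬝ᵥ u = 0 ∧ α ⬝ᵥ u ≠ 0) := by
    apply Gen.ball (P := fun δ α => ∃ u ∈ EE F, δ ⬝ᵥ u = 0 ∧ α ⬝ᵥ u ≠ 0)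
    intro δ _
    obtain ⟨u, hu, hu0, hδu⟩ := exists_mem_inf_hyp hr δ
    obtain ⟨γ, hγ⟩ := exists_dot_ne hu0
    refine ((IsPF.dot u).gen ⟨γ, Submodule.mem_top, hγ⟩).mono ?_
    intro α _ h
    exact ⟨u, hu, hδu, h⟩
  have g2 : Gen (⊤ : Submodule k (Fin n → k)) (fun α => ∀ δ ∈ Δ, DD δ (DD α F) ≠ 0) := by
    apply Gen.ball (P := fun δ α => DD δ (DD α F) ≠ 0)
    intro δ hδ
    have := hΔ1 δ hδ
    rw [dperp_EE] at this
    exact gen_DD_of_not_mem_KK hF hd this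
  have g3 := gen_DDD hF hd hF0
  have g4 : Gen (⊤ : Submodule k (Fin n → k))
      (fun α => ∀ y ∈ L, ∀ t : k, DD α y.1 ≠ t • DD α F) := by
    apply Gen.lball (P := fun (y : MvPolynomial (Fin n) k × ((Fin n → k) → k)) α =>
      ∀ t : k, DD α y.1 ≠ t • DD α F)
    intro y hy
    exact gen_pencil hF (hL y hy).1 hd hr (hL y hy).2
  have g5 : Gen (⊤ : Submodule k (Fin n → k)) (fun α => d = 2 → eval (lc (DD α F)) p ≠ 0) := by
    by_cases h2 : d = 2
    · subst h2
      exact (gen_lc hF hp).mono fun l _ h _ => h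
    · exact ⟨1, ⟨0, Submodule.mem_top, by simp⟩, fun _ _ _ h => absurd h h2⟩
  obtain ⟨α, -, h0, h1, h2, h3, h4, h5⟩ :=
    (g0.and (g1.and (g2.and (g3.and (g4.and g5))))).exists
  refine ⟨α, h0, ?_, h3, h4, h5, ?_⟩
  · by_contra! h
    obtain ⟨δ', hδ', t, ht, hmem⟩ := hΔ2 α h0 (fun w hw hαw => h w ⟨hw, mem_hyp.2 hαw⟩)
    obtain ⟨u, hu, hδu, hαu⟩ := h1 δ' hδ'
    apply hαu
    have := mem_dperp.1 hmem u hu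
    rw [sub_dotProduct, smul_dotProduct, hδu, smul_zero, sub_zero] at this
    exact this
  · have hKK : dperp (EE F) ≤ KK (DD α F) := by
      intro δ hδ
      rw [dperp_EE, mem_KK] at hδ
      rw [mem_KK, DD_comm, hδ, map_zero]
    intro δ hδ hv
    by_cases hc1 : ∀ w ∈ EE F ⊓ hyp δ, eval w p = 0
    · obtain ⟨δ', hδ', t, ht, hmem⟩ := hΔ2 δ hδ (fun w hw hδw => hc1 w ⟨hw, mem_hyp.2 hδw⟩)
      rw [DD_of_sub_mem hmem hKK]
      exact smul_ne_zero ht (h2 δ' hδ')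
    · have hc2 : ∀ w ∈ EE F ⊓ hyp δ, eval w (linForm α) = 0 := by
        by_contra! hc2
        push Not at hc1
        obtain ⟨w, hw, hw'⟩ := gen_mul hc1 hc2
        exact hw' (hv w hw.1 (mem_hyp.1 hw.2))
      have hα : α ∈ dperp (EE F) ⊔ (k ∙ δ) := by
        rw [← dperp_inf_hyp, mem_dperp]
        intro u hu
        rw [← eval_linForm]
        exact hc2 u hu
      obtain ⟨κ, hκ, v, hv', hsum⟩ := Submodule.mem_sup.1 hα
      obtain ⟨c, rfl⟩ := Submodule.mem_span_singleton.1 hv'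
      have e : DD α (DD α F) = c • DD δ (DD α F) :=
        DD_of_sub_mem (W := dperp (EE F)) (by rw [← hsum]; simpa using hκ) hKK
      intro h
      rw [h, smul_zero] at e
      exact h3 e

lemma Dec_derivative {F p : MvPolynomial (Fin n) k} {d : ℕ} {α : Fin n → k} {L : Side k n}
    (hTd : 3 ≤ d → ∀ r, TT k n (d - 1) r)
    (hd : 2 ≤ d) (hF : F.IsHomogeneous d)
    (hp : ∃ w ∈ EE F, eval w p ≠ 0) (hα : α ∉ dperp (EE F)) (hαα : DD α (DD α F) ≠ 0)
    (h2 : d = 2 → eval (lc (DD α F)) p ≠ 0)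
    (hH : HypOK (EE F) (DD α F) (p * linForm α))
    (hL : SideOK (d - 1) (DD α F) L) :
    Dec (d - 1) (NN (finrank k (EE F)) (d - 1)) (DD α F) (EE F) (p * linForm α) L := by
  by_cases hd2 : d = 2
  · subst hd2
    have hlin := linForm_lc (DD_homog α hF)
    have hlin' : DD α F = (1 : k) • linForm (lc (DD α F)) ^ (2 - 1) := by
      simpa using hlin
    refine ⟨[(1, lc (DD α F))], NN_pos _ _, ?_, ?_, single_side hL hlin'⟩
    · intro x hx
      rw [List.mem_singleton.1 hx]
      refine ⟨lc_mem_EE hF α, ?_⟩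
      rw [map_mul]
      refine mul_ne_zero (h2 rfl) ?_
      rw [eval_linForm]
      intro h0
      apply hαα
      rw [hlin, DD_linForm, h0, C_0]
    · rw [PW_cons, PW_nil, add_zero]; exact hlin'
  · refine U_of_T (fun r _ => hTd (by omega) r) (by omega) (DD_homog α hF) ?_ ?_ hH hL
    · rw [EE_le_iff]
      intro δ hδ
      rw [dperp_EE, mem_KK] at hδ
      rw [mem_KK, DD_comm, hδ, map_zero]
    · apply gen_mul hp
      by_contra! h
      apply hα
      rw [mem_dperp]
      intro u hu
      rw [← eval_linForm]
      exact h u hu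

lemma T_step [IsAlgClosed k] {d r : ℕ} (hd : 2 ≤ d) (hr2 : 2 ≤ r)
    (hTd : 3 ≤ d → ∀ r, TT k n (d - 1) r) (hTr : ∀ r' < r, TT k n d r') : TT k n d r := by
  intro F hF hr p L hp hL
  have hd0 : (d : k) ≠ 0 := by exact_mod_cast (by omega : d ≠ 0)
  obtain ⟨α, hα, hαp, hαα, hαL, hα2, hαH⟩ := exists_direction hd hF (by omega) hp hL
  obtain ⟨Γ, hΓ1, hΓ2⟩ := FH (EE F ⊓ hyp α) p hαp
  obtain ⟨s, hs1, hs2, hs3, hs4⟩ := Dec_derivative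
    (L := L.map (fun y => (DD α y.1, y.2)) ++
      Γ.toList.map (fun γ => (DD γ F, fun l => (γ ⬝ᵥ l) / (α ⬝ᵥ l))))
    hTd hd hF hp hα hαα hα2 hαH (by
      intro y hy
      rcases List.mem_append.1 hy with hy | hy
      · obtain ⟨z, hz, rfl⟩ := List.mem_map.1 hy
        exact ⟨DD_homog α (hL z hz).1, hαL z hz⟩
      · obtain ⟨γ, hγ, rfl⟩ := List.mem_map.1 hy
        refine ⟨DD_homog γ hF, ?_⟩
        intro t ht
        apply hΓ1 γ (by simpa using hγ)
        rw [dperp_inf_hyp, dperp_EE, Submodule.mem_sup]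
        refine ⟨γ - t • α, ?_, t • α, Submodule.smul_mem _ _
          (Submodule.mem_span_singleton_self _), by simp⟩
        show DL F (γ - t • α) = 0
        rw [map_sub, map_smul, sub_eq_zero]
        exact ht)
  have hsα : ∀ x ∈ s, α ⬝ᵥ x.2 ≠ 0 := by
    intro x hx
    have := (hs2 x hx).2
    rw [map_mul, eval_linForm] at this
    exact right_ne_zero_of_mul this
  set s' := tw (fun l => ((d : k) * (α ⬝ᵥ l))⁻¹) s with hs'
  have hder : ∀ γ, DD γ (PW d s') = PW (d - 1) (tw (fun l => (γ ⬝ᵥ l) / (α ⬝ᵥ l)) s) := by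
    intro γ
    rw [DD_PW, hs', tw_tw]
    congr 1
    apply tw_congr
    intro x hx
    have := hsα x hx
    field_simp
  have hderα : DD α (PW d s') = DD α F := by
    rw [hder, hs3]
    congr 1
    conv_rhs => rw [← tw_one s]
    apply tw_congr
    intro x hx
    exact div_self (hsα x hx)
  have hG : (F - PW d s').IsHomogeneous d := hF.sub (PW_homog d s')
  have hKG : dperp (EE F ⊓ hyp α) ≤ KK (F - PW d s') := by
    rw [dperp_inf_hyp]
    refine sup_le ?_ ?_
    · intro δ hδ
      have h1 := hδ
      rw [dperp_EE, mem_KK] at h1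
      rw [mem_KK, map_sub, h1, hder, PW_tw_zero, sub_zero]
      intro x hx
      rw [mem_dperp.1 hδ x.2 (hs2 x hx).1, zero_div]
    · rw [Submodule.span_singleton_le_iff_mem, mem_KK, map_sub, hderα, sub_self]
  have hlt := finrank_inf_hyp_lt hα
  obtain ⟨s2, ht1, ht2, ht3, -⟩ := U_of_T (W := EE F ⊓ hyp α) (F := F - PW d s') (p := p) (d := d)
    (L := []) (fun r' hr' => hTr r' (by omega)) hd hG (EE_le_iff.2 hKG) hαp (by
      intro γ hγ hv
      obtain ⟨γ', hγ', t, ht, hmem⟩ := hΓ2 γ hγ hv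
      rw [DD_of_sub_mem hmem hKG]
      refine smul_ne_zero ht ?_
      rw [map_sub, sub_ne_zero, hder]
      exact hs4 (DD γ' F, fun l => (γ' ⬝ᵥ l) / (α ⬝ᵥ l)) (List.mem_append_right _
        (List.mem_map_of_mem (by simpa using hγ')))) (by intro y hy; simp at hy)
  refine ⟨s' ++ s2, ?_, ?_, ?_, ?_⟩
  · rw [List.length_append, hs', tw_length, NN_rec hr2 hd]
    rw [hr] at hs1
    have := NN_mono d (show finrank k (EE F ⊓ hyp α : Submodule k (Fin n → k)) ≤ r - 1 by omega)
    omega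
  · intro x hx
    rcases List.mem_append.1 hx with hx | hx
    · obtain ⟨y, hy, e⟩ := mem_tw hx
      rw [← e]
      refine ⟨(hs2 y hy).1, ?_⟩
      have := (hs2 y hy).2
      rw [map_mul] at this
      exact left_ne_zero_of_mul this
    · exact ⟨(ht2 x hx).1.1, (ht2 x hx).2⟩
  · rw [PW_append, ← ht3]; abel
  · intro y hy e
    apply hs4 (DD α y.1, y.2) (List.mem_append_left _
      (List.mem_map.2 ⟨y, hy, rfl⟩))
    simp only
    rw [e, tw_append, PW_append, map_add, DD_PW, DD_PW, tw_tw, tw_tw, tw_tw,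
      PW_tw_zero (s := s2), add_zero]
    · congr 1
      apply tw_congr
      intro x hx
      have := hsα x hx
      field_simp
    · intro x hx
      rw [mem_hyp.1 (ht2 x hx).1.2]
      simp

lemma T_all [IsAlgClosed k] : ∀ d, 2 ≤ d → ∀ r, TT k n d r := by
  intro d hd
  induction d, hd using Nat.le_induction with
  | base =>
    intro r
    induction r using Nat.strong_induction_on with
    | _ r ih =>
      match r, ih with
      | 0, _ => exact T_zero 2 le_rfl
      | 1, _ => exact T_one 2
      | r + 2, ih => exact T_step le_rfl (by omega) (by omega) ih
  | succ d hd ihd =>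
    intro r
    induction r using Nat.strong_induction_on with
    | _ r ih =>
      match r, ih with
      | 0, _ => exact T_zero _ (by omega)
      | 1, _ => exact T_one _
      | r + 2, ih => exact T_step (by omega) (by omega) (fun _ => by simpa using ihd) ih

end CZ

/-! ### Conclusion -/

lemma eval_smul_of_homog {p : MvPolynomial (Fin n) k} {e : ℕ} (hp : p.IsHomogeneous e) (z : k)
    (a : Fin n → k) : eval (z • a) p = z ^ e * eval a p := by
  rw [eval_eq', eval_eq', Finset.mul_sum]
  apply Finset.sum_congr rfl
  intro s hs
  have hdeg : s.degree = e := by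
    by_contra h
    exact (mem_support_iff.1 hs) (hp.coeff_eq_zero h)
  simp only [Pi.smul_apply, smul_eq_mul, mul_pow, Finset.prod_mul_distrib]
  rw [Finset.prod_pow_eq_pow_sum, ← Finsupp.degree_eq_sum, hdeg]
  ring

lemma PW_writable (d : ℕ) (W : Submodule k (Fin n → k)) (s : List (k × (Fin n → k)))
    (hs : ∀ x ∈ s, x.2 ∈ W) : ∃ G : MvPolynomial (Fin (finrank k W)) k,
      PW d s = aeval (fun j => linForm ((finBasis k W j : W) : Fin n → k)) G := by
  induction s with
  | nil => exact ⟨0, by rw [PW_nil, map_zero]⟩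
  | cons x s ih =>
    obtain ⟨G, hG⟩ := ih fun y hy => hs y (by simp [hy])
    have hx := hs x (by simp)
    refine ⟨x.1 • linForm (fun j => (finBasis k W).repr ⟨x.2, hx⟩ j) ^ d + G, ?_⟩
    rw [PW_cons, map_add, ← hG, map_smul, map_pow]
    congr 3
    have e : x.2 = ∑ j, (finBasis k W).repr ⟨x.2, hx⟩ j • ((finBasis k W j : W) : Fin n → k) := by
      have := congrArg (fun w : W => (w : Fin n → k)) ((finBasis k W).sum_repr ⟨x.2, hx⟩)
      simp only [Submodule.coe_sum, Submodule.coe_smul] at this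
      exact this.symm
    have hsum : ∀ f : Fin (finrank k W) → Fin n → k, linForm (∑ j, f j) = ∑ j, linForm (f j) := by
      intro f
      exact map_sum (⟨⟨linForm, linForm_zero⟩, linForm_add⟩ : (Fin n → k) →+ MvPolynomial (Fin n) k)
        f Finset.univ
    conv_lhs => rw [e, hsum]
    simp only [linForm_smul]
    conv_rhs => rw [linForm]
    simp [smul_eq_C_mul]

lemma PW_roots [IsAlgClosed k] {d e : ℕ} (hd : d ≠ 0) {p : MvPolynomial (Fin n) k}
    (hp : p.IsHomogeneous e) (s : List (k × (Fin n → k))) (hs : ∀ x ∈ s, eval x.2 p ≠ 0) :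
    ∃ t : List (Fin n → k), t.length ≤ s.length ∧ (∀ l ∈ t, eval l p ≠ 0) ∧
      PW d s = (t.map fun l => linForm l ^ d).sum := by
  induction s with
  | nil => exact ⟨[], le_rfl, by simp, rfl⟩
  | cons x s ih =>
    obtain ⟨t, h1, h2, h3⟩ := ih fun y hy => hs y (by simp [hy])
    by_cases hx : x.1 = 0
    · refine ⟨t, by simp; omega, h2, ?_⟩
      rw [PW_cons, hx, zero_smul, zero_add, h3]
    · obtain ⟨z, hz⟩ := IsAlgClosed.exists_pow_nat_eq x.1 (Nat.pos_of_ne_zero hd)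
      have hz0 : z ≠ 0 := by
        rintro rfl
        rw [zero_pow hd] at hz
        exact hx hz.symm
      refine ⟨(z • x.2) :: t, by simpa using h1, ?_, ?_⟩
      · intro l hl
        rcases List.mem_cons.1 hl with rfl | hl
        · rw [eval_smul_of_homog hp]
          exact mul_ne_zero (pow_ne_zero _ hz0) (hs x (by simp))
        · exact h2 l hl
      · rw [PW_cons, List.map_cons, List.sum_cons, ← h3, linForm_smul, smul_pow, hz]

lemma EE_eq_top [IsAlgClosed k] [CharZero k] {d : ℕ} (hd : 2 ≤ d) {F : MvPolynomial (Fin n) k}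
    (hF : F.IsHomogeneous d) (hE : EssDep F) : EE F = ⊤ := by
  by_contra hne
  have hlt : finrank k (EE F) < n := by
    have := Submodule.finrank_lt hne
    simpa using this
  obtain ⟨s, -, hs, hFs, -⟩ := T_all d hd _ F hF rfl 1 [] ⟨0, Submodule.zero_mem _, by simp⟩
    (by intro y hy; simp at hy)
  obtain ⟨G, hG⟩ := PW_writable d (EE F) s fun x hx => (hs x hx).1
  exact hE _ hlt ⟨_, fun j => linForm_homog _, G, hFs.trans hG⟩

lemma OrkV_le [IsAlgClosed k] [CharZero k] {d : ℕ} (hd : 2 ≤ d) {F : MvPolynomial (Fin n) k}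
    (hF : F.IsHomogeneous d) (hE : EssDep F) {V : Set (Fin n → k)} (hV : HomZariskiClosed V)
    (hV' : V ≠ Set.univ) : OrkV d F V ≤ (NN n d : ℕ∞) := by
  obtain ⟨P, hP, rfl⟩ := hV
  obtain ⟨a, ha⟩ := (Set.ne_univ_iff_exists_notMem _).1 hV'
  simp only [Set.mem_ofPred_eq, not_forall] at ha
  obtain ⟨p, hpP, hpa⟩ := ha
  obtain ⟨e, hpe⟩ := hP p hpP
  have htop := EE_eq_top hd hF hE
  have hfr : finrank k (EE F) = n := by rw [htop]; simp
  obtain ⟨s, hs1, hs2, hFs, -⟩ := T_all d hd _ F hF rfl p []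
    ⟨a, by rw [htop]; exact Submodule.mem_top, hpa⟩ (by intro y hy; simp at hy)
  obtain ⟨t, ht1, ht2, ht3⟩ := PW_roots (d := d) (by omega) hpe s fun x hx => (hs2 x hx).2
  rw [hfr] at hs1
  refine le_trans (sInf_le ⟨t.length, ⟨fun i => t[i], ?_, ?_⟩, rfl⟩) ?_
  · intro i hi
    exact ht2 _ (List.getElem_mem i.2) (hi p hpP)
  · rw [hFs, ht3]
    exact (Fin.sum_univ_fun_getElem t fun l => linForm l ^ d).symm
  · show ((t.length : ℕ) : ℕ∞) ≤ _
    exact_mod_cast ht1.trans hs1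

end WaringProof


/-- For all integers `n ≥ 2` and `d ≥ 2`, the open Waring rank satisfies
`Ork(n, d) ≤ binom(n+d-2, d-1)`. -/
theorem stmt_3 (k : Type) [Field k] [IsAlgClosed k] [CharZero k]
    (n d : ℕ) (hn : 2 ≤ n) (hd : 2 ≤ d) :
    OrkND k n d ≤ ((n + d - 2).choose (d - 1) : ℕ∞) := by
  have e : ((n + d - 2).choose (d - 1)) = NN n d := by
    unfold NN
    congr 1
    omega
  rw [e]
  refine iSup_le fun F => iSup_le fun V => ?_
  exact OrkV_le hd F.2.1 F.2.2 V.2.1 V.2.2
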